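/- arXiv:0706.4358 — 2 statements merged into one kernel-verified Lean document; each statement's English description precedes it below -/
import Mathlib

section
/- Let V ⊆ F_2^{67} be a binary linear code whose nonzero words all have weight in {24, 32, 56}. Then dim V ≤ 10. -/
open Finset

/-- Hamming weight of a word over `ZMod 2`. -/
def wt {ι : Type*} [Fintype ι] (v : ι → ZMod 2) : ℕ :=
  (Finset.univ.filter fun i => v i ≠ 0).card

/-- The dual code: annihilator under the standard scalar product. -/
def dualCode {n : ℕ} (V : Submodule (ZMod 2) (Fin n → ZMod 2)) :
    Submodule (ZMod 2) (Fin n → ZMod 2) where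
  carrier := {w | ∀ v ∈ V, ∑ i, v i * w i = 0}
  add_mem' := by
    intro a b ha hb v hv
    simp only [Pi.add_apply, mul_add, Finset.sum_add_distrib, ha v hv, hb v hv, add_zero]
  zero_mem' := by intro v hv; simp
  smul_mem' := by
    intro c a ha v hv
    have h := ha v hv
    calc ∑ i, v i * (c • a) i = c * ∑ i, v i * a i := by
          simp [Finset.mul_sum, mul_left_comm]
      _ = 0 := by rw [h, mul_zero]

/-- A code is spanning if the union of supports of its words is everything. -/
def Spanning {n : ℕ} (V : Submodule (ZMod 2) (Fin n → ZMod 2)) : Prop :=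
  ∀ i : Fin n, ∃ v ∈ V, v i ≠ 0


/-- Fibers of a homomorphism out of a group of order divisible by `d * e` into a group of order `d`
have cardinality divisible by `e`. -/
lemma fiber_dvd {G W : Type*} [AddCommGroup G] [Fintype G] [AddCommGroup W] [Fintype W]
    [DecidableEq W] (f : G →+ W) (d e : ℕ) (hd : 0 < d) (hW : Nat.card W = d)
    (hG : d * e ∣ Nat.card G) (y : W) :
    e ∣ (Finset.univ.filter fun g => f g = y).card := by
  by_cases hy : ∃ g0, f g0 = y
  · obtain ⟨g0, rfl⟩ := hy
    have h1 : (Finset.univ.filter fun g => f g = f g0).card = Nat.card f.ker := by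
      rw [← Fintype.card_subtype, ← Nat.card_eq_fintype_card]
      refine Nat.card_congr ⟨fun g => ⟨g.1 - g0, ?_⟩, fun k => ⟨k.1 + g0, ?_⟩, ?_, ?_⟩
      · rw [AddMonoidHom.mem_ker, map_sub, g.2, sub_self]
      · rw [map_add, (AddMonoidHom.mem_ker).1 k.2, zero_add]
      · intro g; simp
      · intro k; simp
    rw [h1]
    have h2 : Nat.card f.ker * Nat.card f.range = Nat.card G := by
      rw [← AddSubgroup.card_mul_index f.ker, AddSubgroup.index_ker]
    have h3 : Nat.card f.range ∣ d := hW ▸ AddSubgroup.card_addSubgroup_dvd_card f.range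
    have h4 : d * e ∣ d * Nat.card f.ker := by
      refine hG.trans ?_
      rw [← h2, mul_comm d]
      exact mul_dvd_mul_left _ h3
    exact Nat.dvd_of_mul_dvd_mul_left hd h4
  · rw [Finset.filter_eq_empty_iff.2]
    · simp
    · intro g _ h
      exact hy ⟨g, h⟩

lemma zmod2_ne (a : ZMod 2) : a ≠ 0 ↔ a = 1 := by
  revert a; decide

set_option linter.constructorNameAsVariable false

theorem stmt11 (V : Submodule (ZMod 2) (Fin 67 → ZMod 2))
    (hwt : ∀ v ∈ V, v ≠ 0 → wt v = 24 ∨ wt v = 32 ∨ wt v = 56) :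
    Module.finrank (ZMod 2) V ≤ 10 := by
  classical
  by_contra hk
  have hk : 11 ≤ Module.finrank (ZMod 2) V := by omega
  have hV : 2048 ∣ Nat.card V := by
    rw [Module.natCard_eq_pow_finrank (K := ZMod 2), Nat.card_zmod]
    exact pow_dvd_pow 2 hk
  -- single coordinates
  have hone : ∀ i, 1024 ∣ (Finset.univ.filter fun v : V => v.1 i ≠ 0).card := by
    intro i
    have := fiber_dvd (((LinearMap.proj i : (Fin 67 → ZMod 2) →ₗ[ZMod 2] ZMod 2).comp
      V.subtype).toAddMonoidHom) 2 1024 (by norm_num) (Nat.card_zmod 2) hV 1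
    convert this using 2
    ext v
    rw [Finset.mem_filter, Finset.mem_filter, zmod2_ne]
    rfl
  have htwo : ∀ i j, 512 ∣ (Finset.univ.filter fun v : V => v.1 i ≠ 0 ∧ v.1 j ≠ 0).card := by
    intro i j
    have := fiber_dvd
      ((((LinearMap.proj i : (Fin 67 → ZMod 2) →ₗ[ZMod 2] ZMod 2).prod
        (LinearMap.proj j : (Fin 67 → ZMod 2) →ₗ[ZMod 2] ZMod 2)).comp
      V.subtype).toAddMonoidHom) 4 512 (by norm_num) (by simp) hV (1, 1)
    convert this using 2
    ext v
    simp [zmod2_ne, Prod.ext_iff]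
  have hsum1 : 1024 ∣ ∑ v : V, wt v.1 := by
    have : ∑ v : V, wt v.1 = ∑ i, (Finset.univ.filter fun v : V => v.1 i ≠ 0).card := by
      simp only [wt, Finset.card_filter]
      exact Finset.sum_comm
    rw [this]
    exact Finset.dvd_sum fun i _ => hone i
  have hsum2 : 512 ∣ ∑ v : V, (wt v.1).choose 2 := by
    have : ∑ v : V, (wt v.1).choose 2 = ∑ p ∈ Finset.powersetCard 2 (Finset.univ : Finset (Fin 67)),
        (Finset.univ.filter fun v : V => ∀ i ∈ p, v.1 i ≠ 0).card := by
      simp only [Finset.card_filter]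
      rw [Finset.sum_comm]
      refine Finset.sum_congr rfl fun v _ => ?_
      rw [← Finset.card_filter, wt, ← Finset.card_powersetCard]
      refine congrArg Finset.card (Finset.ext fun p => ?_)
      simp only [Finset.mem_powersetCard, Finset.mem_filter, Finset.subset_iff, Finset.mem_univ,
        true_and, implies_true]
      exact and_comm
    rw [this]
    refine Finset.dvd_sum fun p hp => ?_
    obtain ⟨i, j, _, rfl⟩ := Finset.card_eq_two.1 (Finset.mem_powersetCard.1 hp).2
    simpa using htwo i j
  -- at most one word of weight 56
  have hc : (Finset.univ.filter fun v : V => wt v.1 = 56).card ≤ 1 := by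
    refine Finset.card_le_one.2 fun u hu v hv => ?_
    rw [Finset.mem_filter] at hu hv
    by_contra huv
    have hne : u.1 + v.1 ≠ 0 := by
      intro h
      apply huv
      ext i
      have hi := congrFun h i
      simp only [Pi.add_apply, Pi.zero_apply] at hi
      generalize u.1 i = a at *
      generalize v.1 i = b at *
      revert a b; decide
    have hw := hwt _ (V.add_mem u.2 v.2) hne
    have hu := hu.2
    have hv := hv.2
    simp only [wt] at hu hv hw
    set A := Finset.univ.filter fun i => u.1 i ≠ 0
    set B := Finset.univ.filter fun i => v.1 i ≠ 0
    have h1 := Finset.card_union_add_card_inter A B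
    have h2 : (A ∪ B).card ≤ 67 := by simpa using Finset.card_le_univ (A ∪ B)
    have h3 : (Finset.univ.filter fun i => (u.1 + v.1) i ≠ 0) ⊆ (A ∪ B) \ (A ∩ B) := by
      intro i hi
      simp only [A, B, Finset.mem_filter, Finset.mem_univ, true_and, Finset.mem_sdiff,
        Finset.mem_union, Finset.mem_inter, Pi.add_apply] at hi ⊢
      generalize u.1 i = a at *
      generalize v.1 i = b at *
      revert a b; decide
    have h4 := Finset.card_le_card h3
    have h5 : A ∩ B ⊆ A ∪ B := fun i hi => Finset.mem_union_left _ (Finset.mem_inter.1 hi).1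
    rw [Finset.card_sdiff_of_subset h5] at h4
    omega
  -- the key identity
  have key : ∀ v : V, 2 * (wt v.1).choose 2 + 768 =
      55 * wt v.1 - 0 + (if v = 0 then 768 else 0) + 768 * (if wt v.1 = 56 then 1 else 0) := by
    intro v
    by_cases h0 : v = 0
    · subst h0; simp [wt]
    · rcases hwt v.1 v.2 (by simpa using h0) with h | h | h <;> simp [h, h0, Nat.choose]
  have tot := Finset.sum_congr (rfl : (Finset.univ : Finset V) = _) fun v _ => key v
  simp only [Nat.sub_zero, Finset.sum_add_distrib, ← Finset.mul_sum, Finset.sum_const,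
    Finset.sum_ite_eq', Finset.mem_univ, if_true, ← Finset.card_filter, Finset.card_univ,
    smul_eq_mul] at tot
  rw [Nat.card_eq_fintype_card] at hV
  omega
end

section
/- Let V ⊆ F_2^{66} be a binary linear code whose nonzero words all have weight in {24, 32, 40, 56}. Then dim V ≤ 12. -/
open Finset

namespace Sextic

/-- The additive character of `ZMod 2` with integer values. -/
def sg (a : ZMod 2) : ℤ := if a = 0 then 1 else -1

lemma sg_add : ∀ a b : ZMod 2, sg (a + b) = sg a * sg b := by decide

lemma sg_zero : sg 0 = 1 := by decide

lemma sg_ne : ∀ a : ZMod 2, a ≠ 0 → sg a = -1 := by decide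

lemma wt_eq_sum {ι : Type*} [Fintype ι] (v : ι → ZMod 2) :
    (wt v : ℤ) = ∑ i, ((v i).val : ℤ) := by
  have h : ∀ a : ZMod 2, ((a.val : ℕ) : ℤ) = if a ≠ 0 then 1 else 0 := by decide
  simp only [h, wt, Finset.card_filter]
  push_cast
  rfl

lemma sum_sg {ι : Type*} [Fintype ι] (v : ι → ZMod 2) :
    ∑ i, sg (v i) = (Fintype.card ι : ℤ) - 2 * wt v := by
  have h : ∀ a : ZMod 2, sg a = 1 - 2 * ((a.val : ℕ) : ℤ) := by decide
  simp only [h, wt_eq_sum, Finset.sum_sub_distrib, Finset.mul_sum]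
  simp

lemma wt_zero {ι : Type*} [Fintype ι] : wt (0 : ι → ZMod 2) = 0 := by simp [wt]

/-- Inclusion–exclusion for three words. -/
lemma wt_triple {ι : Type*} [Fintype ι] (a b c : ι → ZMod 2) :
    (wt (a + b + c) : ℤ) + wt a + wt b + wt c - wt (a + b) - wt (b + c) - wt (a + c)
      = 4 * wt (fun i => c i * (a i * b i)) := by
  have h : ∀ x y z : ZMod 2, (((x + y + z).val : ℕ) : ℤ) + (x.val : ℕ) + (y.val : ℕ)
      + (z.val : ℕ) - ((x + y).val : ℕ) - ((y + z).val : ℕ) - ((x + z).val : ℕ)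
      = 4 * ((z * (x * y)).val : ℕ) := by decide
  simp only [wt_eq_sum, Finset.mul_sum, ← Finset.sum_add_distrib, ← Finset.sum_sub_distrib]
  exact Finset.sum_congr rfl fun i _ => h (a i) (b i) (c i)

lemma wt_add {ι : Type*} [Fintype ι] (a b : ι → ZMod 2) :
    (wt (a + b) : ℤ) + 2 * wt (a * b) = wt a + wt b := by
  have h : ∀ x y : ZMod 2, (((x + y).val : ℕ) : ℤ) + 2 * ((x * y).val : ℕ)
      = (x.val : ℕ) + (y.val : ℕ) := by decide
  simp only [wt_eq_sum, Finset.mul_sum, ← Finset.sum_add_distrib]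
  exact Finset.sum_congr rfl fun i _ => h (a i) (b i)

lemma wt_inter_ge {ι : Type*} [Fintype ι] (a b : ι → ZMod 2) :
    (wt a : ℤ) + wt b ≤ Fintype.card ι + wt (a * b) := by
  have h : ∀ x y : ZMod 2, ((x.val : ℕ) : ℤ) + (y.val : ℕ) ≤ 1 + ((x * y).val : ℕ) := by decide
  have : (Fintype.card ι : ℤ) = ∑ _i : ι, (1 : ℤ) := by simp
  rw [this]
  simp only [wt_eq_sum, ← Finset.sum_add_distrib]
  exact Finset.sum_le_sum fun i _ => h (a i) (b i)

lemma sum_eq_wt {ι : Type*} [Fintype ι] (v : ι → ZMod 2) : ∑ i, v i = (wt v : ZMod 2) := by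
  have h : ∀ a : ZMod 2, a = if a ≠ 0 then 1 else 0 := by decide
  rw [wt, Finset.card_filter]
  push_cast
  exact Finset.sum_congr rfl fun i _ => h (v i)

/-- Orthogonality of characters. -/
lemma sum_char {V : Type*} [AddCommGroup V] [Fintype V] (φ : V →+ ZMod 2) :
    (∑ v, sg (φ v) = 0) ∨ (∑ v, sg (φ v) = Fintype.card V) := by
  by_cases h : ∀ v, φ v = 0
  · right; simp [h, sg_zero]
  · left
    push Not at h
    obtain ⟨v0, h0⟩ := h
    have := Equiv.sum_comp (Equiv.addRight v0) (fun v => sg (φ v))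
    simp only [Equiv.coe_addRight, map_add, sg_add, sg_ne _ h0] at this
    rw [← Finset.sum_mul] at this
    linarith

section

variable (V : Submodule (ZMod 2) (Fin 66 → ZMod 2))

/-- The two moments used. -/
lemma moments [Fintype V] : ∃ N : ℤ, 38 ≤ N ∧
    ∑ v : V, ((64 - 2 * (wt v.1 : ℤ)) * (80 - 2 * wt v.1)) = Fintype.card V * N := by
  have h1 : ∀ i : Fin 66, ∃ b : ℤ, 0 ≤ b ∧ ∑ v : V, sg (v.1 i) = Fintype.card V * b := by
    intro i
    let φ : V →+ ZMod 2 :=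
      { toFun := fun v => v.1 i, map_zero' := rfl, map_add' := fun _ _ => rfl }
    rcases sum_char φ with h | h
    · exact ⟨0, le_rfl, by rw [mul_zero]; exact h⟩
    · exact ⟨1, zero_le_one, by rw [mul_one]; exact h⟩
  have h2 : ∀ i j : Fin 66, ∃ b : ℤ, (if i = j then 1 else 0) ≤ b ∧
      ∑ v : V, sg (v.1 i) * sg (v.1 j) = Fintype.card V * b := by
    intro i j
    by_cases hij : i = j
    · subst hij
      refine ⟨1, by simp, ?_⟩
      have h : ∀ a : ZMod 2, sg a * sg a = 1 := by decide
      simp [h]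
    · simp only [hij, if_false]
      let φ : V →+ ZMod 2 :=
        { toFun := fun v => v.1 i + v.1 j, map_zero' := by simp,
          map_add' := fun x y => by
            simp only [Submodule.coe_add, Pi.add_apply]; ring }
      simp only [← sg_add]
      rcases sum_char φ with h | h
      · exact ⟨0, le_rfl, by rw [mul_zero]; exact h⟩
      · exact ⟨1, zero_le_one, by rw [mul_one]; exact h⟩
  choose b hb0 hb using h1
  choose q hq0 hq using h2
  have hB : 0 ≤ ∑ i, b i := Finset.sum_nonneg fun i _ => hb0 i
  have hQ : 66 ≤ ∑ i, ∑ j, q i j := by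
    calc (66 : ℤ) = ∑ i : Fin 66, ∑ j : Fin 66, (if i = j then 1 else 0) := by simp
      _ ≤ _ := Finset.sum_le_sum fun i _ => Finset.sum_le_sum fun j _ => hq0 i j
  have S1 : ∑ v : V, ∑ i, sg (v.1 i) = Fintype.card V * ∑ i, b i := by
    rw [Finset.sum_comm, Finset.mul_sum]
    exact Finset.sum_congr rfl fun i _ => hb i
  have S2 : ∑ v : V, (∑ i, sg (v.1 i)) * (∑ j, sg (v.1 j))
      = Fintype.card V * ∑ i, ∑ j, q i j := by
    simp only [Finset.sum_mul_sum]
    rw [Finset.sum_comm, Finset.mul_sum]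
    refine Finset.sum_congr rfl fun i _ => ?_
    rw [Finset.sum_comm, Finset.mul_sum]
    exact Finset.sum_congr rfl fun j _ => hq i j
  refine ⟨∑ i, ∑ j, q i j + 12 * ∑ i, b i - 28, by linarith, ?_⟩
  have : ∀ v : V, ((64 - 2 * (wt v.1 : ℤ)) * (80 - 2 * wt v.1))
      = (∑ i, sg (v.1 i)) * (∑ j, sg (v.1 j)) + 12 * (∑ i, sg (v.1 i)) - 28 := by
    intro v
    rw [sum_sg]
    simp only [Fintype.card_fin]
    push_cast
    ring
  simp only [this, Finset.sum_sub_distrib, Finset.sum_add_distrib, ← Finset.mul_sum, S1, S2]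
  simp
  ring

variable {V}

lemma wt_cases
    (hwt : ∀ v ∈ V, v ≠ 0 → wt v = 24 ∨ wt v = 32 ∨ wt v = 40 ∨ wt v = 56)
    {v} (hv : v ∈ V) : wt v = 0 ∨ wt v = 24 ∨ wt v = 32 ∨ wt v = 40 ∨ wt v = 56 := by
  by_cases h : v = 0
  · left; rw [h, wt_zero]
  · right; exact hwt v hv h

lemma triple_zero
    (hwt : ∀ v ∈ V, v ≠ 0 → wt v = 24 ∨ wt v = 32 ∨ wt v = 40 ∨ wt v = 56)
    {a b c} (ha : a ∈ V) (hb : b ∈ V) (hc : c ∈ V) :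
    ∑ i, c i * (a i * b i) = 0 := by
  rw [sum_eq_wt (fun i => c i * (a i * b i))]
  have h := wt_triple a b c
  have d : ∀ v ∈ V, ∃ k : ℤ, (wt v : ℤ) = 8 * k := by
    intro v hv
    have := wt_cases hwt hv
    exact ⟨(wt v : ℤ) / 8, by omega⟩
  obtain ⟨k1, h1⟩ := d _ ha
  obtain ⟨k2, h2⟩ := d _ hb
  obtain ⟨k3, h3⟩ := d _ hc
  obtain ⟨k4, h4⟩ := d _ (V.add_mem ha hb)
  obtain ⟨k5, h5⟩ := d _ (V.add_mem hb hc)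
  obtain ⟨k6, h6⟩ := d _ (V.add_mem ha hc)
  obtain ⟨k7, h7⟩ := d _ (V.add_mem (V.add_mem ha hb) hc)
  rw [ZMod.natCast_eq_zero_iff]
  omega

/-- If `dim V > 12`, some nonzero word of `V` is disjoint from any given word of weight 24. -/
lemma exists_disjoint
    (hwt : ∀ v ∈ V, v ≠ 0 → wt v = 24 ∨ wt v = 32 ∨ wt v = 40 ∨ wt v = 56)
    (hk : 12 < Module.finrank (ZMod 2) V) {c} (hc : c ∈ V) (hc24 : wt c = 24) :
    ∃ x ∈ V, x ≠ 0 ∧ c * x = 0 := by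
  by_contra hcon
  push Not at hcon
  let B := Module.finBasis (ZMod 2) V
  let f : V →ₗ[ZMod 2] ({i // c i ≠ 0} → ZMod 2) :=
    (LinearMap.funLeft (ZMod 2) (ZMod 2) (Subtype.val : {i // c i ≠ 0} → Fin 66)).comp V.subtype
  have hf : LinearMap.ker f = ⊥ := by
    rw [LinearMap.ker_eq_bot']
    intro x hx
    by_contra hx0
    apply hcon x.1 x.2 (by simpa using hx0)
    funext i
    by_cases hi : c i = 0
    · simp [hi]
    · have := congrFun hx ⟨i, hi⟩
      have h2 : x.1 i = 0 := this
      simp [h2]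
  have hli : LinearIndependent (ZMod 2) (fun j => f (B j)) := B.linearIndependent.map' f hf
  let M : Matrix (Fin (Module.finrank (ZMod 2) V)) {i // c i ≠ 0} (ZMod 2) := fun j => f (B j)
  have hr : M.rank = Module.finrank (ZMod 2) V := by
    have := LinearIndependent.rank_matrix (M := M) hli
    simpa using this
  have hM : M * M.transpose = 0 := by
    ext j l
    have h3 := triple_zero hwt (B j).2 (B l).2 hc
    rw [Matrix.mul_apply]
    change ∑ i : {i // c i ≠ 0}, (B j).1 i * (B l).1 i = 0
    refine Eq.trans ?_ h3
    have h1 : ∀ a z : ZMod 2, a * z = if a ≠ 0 then z else 0 := by decide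
    simp only [h1 (c _)]
    rw [← Finset.sum_filter]
    exact (Finset.sum_subtype (Finset.univ.filter fun i => c i ≠ 0) (by simp)
      (fun i => (B j).1 i * (B l).1 i)).symm
  have := Matrix.rank_add_rank_le_card_of_mul_eq_zero hM
  rw [Matrix.rank_transpose, hr, Fintype.card_subtype] at this
  have h24 : (Finset.univ.filter fun i => c i ≠ 0).card = 24 := hc24
  omega

/-- Any word of weight 24 is contained in a word of weight 56. -/
lemma exists_56
    (hwt : ∀ v ∈ V, v ≠ 0 → wt v = 24 ∨ wt v = 32 ∨ wt v = 40 ∨ wt v = 56)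
    (hk : 12 < Module.finrank (ZMod 2) V) {c} (hc : c ∈ V) (hc24 : wt c = 24) :
    ∃ e ∈ V, wt e = 56 ∧ wt (c + e) = 32 := by
  obtain ⟨x, hx, hx0, hcx⟩ := exists_disjoint hwt hk hc hc24
  have h1 := wt_add c x
  have h2 := wt_inter_ge c x
  rw [hcx, wt_zero] at h1 h2
  simp only [Fintype.card_fin] at h2
  have h3 := hwt x hx hx0
  have h4 := wt_cases hwt (V.add_mem hc hx)
  have h5 : c + (c + x) = x := by
    rw [← add_assoc, CharTwo.add_self_eq_zero, zero_add]
  refine ⟨c + x, V.add_mem hc hx, by omega, ?_⟩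
  rw [h5]
  omega

lemma unique_56
    (hwt : ∀ v ∈ V, v ≠ 0 → wt v = 24 ∨ wt v = 32 ∨ wt v = 40 ∨ wt v = 56)
    {e e'} (he : e ∈ V) (he' : e' ∈ V) (h : wt e = 56) (h' : wt e' = 56) :
    e' = e := by
  have h1 := wt_add e e'
  have h2 := wt_inter_ge e e'
  simp only [Fintype.card_fin] at h2
  by_contra hne
  have h3 : e + e' ≠ 0 := by
    intro h0
    exact hne (CharTwo.add_eq_zero.1 h0).symm
  have h4 := hwt _ (V.add_mem he he') h3
  omega

lemma final
    (hwt : ∀ v ∈ V, v ≠ 0 → wt v = 24 ∨ wt v = 32 ∨ wt v = 40 ∨ wt v = 56)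
    (hk : 12 < Module.finrank (ZMod 2) V) : False := by
  classical
  have : Fintype V := Fintype.ofFinite V
  obtain ⟨N, hN, hsum⟩ := moments V
  have hcard : (Fintype.card V : ℤ) = 2 ^ Module.finrank (ZMod 2) V := by
    have := Module.card_eq_pow_finrank (K := ZMod 2) (V := V)
    rw [this, ZMod.card]; push_cast; rfl
  obtain ⟨r, hr⟩ := Nat.exists_eq_add_of_lt hk
  -- weight counts
  let A : ℕ := (Finset.univ.filter fun v : V => wt v.1 = 24).card
  let T : ℕ := (Finset.univ.filter fun v : V => wt v.1 = 56).card
  have hpt : ∀ v : V, ((64 - 2 * (wt v.1 : ℤ)) * (80 - 2 * wt v.1)) =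
      5120 * (if v = 0 then 1 else 0) + 512 * (if wt v.1 = 24 then 1 else 0)
        + 1536 * (if wt v.1 = 56 then 1 else 0) := by
    intro v
    by_cases hv : v = 0
    · subst hv; simp [wt_zero]
    · have hv' : v.1 ≠ 0 := by simpa using hv
      rcases hwt v.1 v.2 hv' with h | h | h | h <;> simp [h, hv]
  have hcount : (5120 : ℤ) + 512 * A + 1536 * T = Fintype.card V * N := by
    rw [← hsum]
    simp only [hpt, Finset.sum_add_distrib, ← Finset.mul_sum]
    simp [A, T]
  have hmain : ∃ N' : ℤ, 38 ≤ N' ∧ (10 : ℤ) + A + 3 * T = 16 * N' := by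
    have hp : (1 : ℤ) ≤ 2 ^ r := one_le_pow₀ (by norm_num)
    refine ⟨2 ^ r * N, by nlinarith, ?_⟩
    have : (Fintype.card V : ℤ) = 8192 * 2 ^ r := by
      rw [hcard, hr, pow_add, pow_add]; norm_num; ring
    rw [this] at hcount
    linarith
  obtain ⟨N', hN', hA⟩ := hmain
  have hT : T ≤ 1 := by
    rw [Finset.card_le_one]
    intro a ha b hb
    simp only [Finset.mem_filter, Finset.mem_univ, true_and] at ha hb
    exact Subtype.ext (unique_56 hwt b.2 a.2 hb ha)
  have hApos : 0 < A := by omega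
  obtain ⟨c, hc⟩ := Finset.card_pos.1 hApos
  simp only [Finset.mem_filter, Finset.mem_univ, true_and] at hc
  obtain ⟨e, he, he56, -⟩ := exists_56 hwt hk c.2 hc
  have hT1 : T = 1 := by
    have : 0 < T := Finset.card_pos.2 ⟨⟨e, he⟩, by simp [he56]⟩
    omega
  -- the words inside `e`
  let W : Submodule (ZMod 2) V :=
    { carrier := {v | v.1 * e = v.1}
      zero_mem' := by simp
      add_mem' := by
        intro a b ha hb
        simp only [Set.mem_ofPred_eq, Submodule.coe_add, add_mul] at *
        rw [ha, hb]
      smul_mem' := by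
        intro t a ha
        simp only [Set.mem_ofPred_eq, Submodule.coe_smul, smul_mul_assoc] at *
        rw [ha] }
  have hW : ∀ v : V, v ∈ W ↔ v.1 * e = v.1 := fun v => Iff.rfl
  have hee : e * e = e := by
    funext i
    have : ∀ a : ZMod 2, a * a = a := by decide
    exact this (e i)
  have heW : (⟨e, he⟩ : V) ∈ W := by rw [hW]; exact hee
  have h24W : ∀ v : V, wt v.1 = 24 → v ∈ W := by
    intro v hv
    obtain ⟨e', he', h56, h32⟩ := exists_56 hwt hk v.2 hv
    have : e' = e := unique_56 hwt he he' he56 h56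
    subst this
    have h1 := wt_add v.1 e'
    have h2 : wt (v.1 * e') = wt v.1 := by omega
    rw [hW]
    funext i
    by_contra hne
    have hlt : wt (v.1 * e') < wt v.1 := by
      apply Finset.card_lt_card
      rw [Finset.ssubset_iff_of_subset]
      · refine ⟨i, ?_, ?_⟩
        · simp only [Finset.mem_filter, Finset.mem_univ, true_and]
          intro h0; apply hne; simp [h0]
        · simp only [Finset.mem_filter, Finset.mem_univ, true_and, not_not]
          have : ∀ a b : ZMod 2, a * b ≠ a → a * b = 0 := by decide
          exact this _ _ hne
      · intro j hj
        simp only [Finset.mem_filter, Finset.mem_univ, true_and, Pi.mul_apply] at hj ⊢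
        exact left_ne_zero_of_mul hj
    omega
  have : Fintype W := Fintype.ofFinite W
  let g : W → ℤ := fun w => (if w = 0 then 1 else 0) + (if wt w.1.1 = 24 then 1 else 0)
  let E : W := ⟨⟨e, he⟩, heW⟩
  have hg : ∀ w : W, g w + g (w + E) = 1 := by
    intro w
    have hw : w.1.1 * e = w.1.1 := w.2
    have h1 := wt_add w.1.1 e
    rw [hw] at h1
    have h2 := wt_cases hwt w.1.2
    have h3 := wt_cases hwt (V.add_mem w.1.2 he)
    have hz : ∀ w : W, w = 0 ↔ wt w.1.1 = 0 := by
      intro w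
      constructor
      · rintro rfl; simp [wt_zero]
      · intro h
        by_contra hne
        have : w.1.1 ≠ 0 := by simpa using hne
        have := hwt _ w.1.2 this
        omega
    have hwe : (w + E).1.1 = w.1.1 + e := rfl
    simp only [g, hz, hwe]
    split_ifs <;> omega
  have hgsum : ∑ w, g w = 1 + A := by
    simp only [g, Finset.sum_add_distrib]
    congr 1
    · simp
    · rw [← Finset.sum_filter]
      simp only [Finset.sum_const, nsmul_eq_mul, mul_one, Nat.cast_inj]
      apply Finset.card_bij (fun w _ => w.1)
      · intro w hw; simpa using hw
      · intro a _ b _ h; exact Subtype.ext h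
      · intro v hv
        have hv' : wt v.1 = 24 := by simpa using hv
        exact ⟨⟨v, h24W v hv'⟩, by simpa using hv', rfl⟩
  have hWcard : (Fintype.card W : ℤ) = 2 * (1 + A) := by
    have h1 : ∑ w, (g w + g (w + E)) = Fintype.card W := by simp [hg]
    have h2 : ∑ w, g (w + E) = ∑ w, g w := Equiv.sum_comp (Equiv.addRight E) g
    rw [Finset.sum_add_distrib, h2, hgsum] at h1
    linarith
  have hWpow : Fintype.card W = 2 ^ Module.finrank (ZMod 2) W := by
    have := Module.card_eq_pow_finrank (K := ZMod 2) (V := W)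
    rwa [ZMod.card] at this
  have hdiv : 32 ∣ Fintype.card W := by
    rw [hWpow]
    have h5 : 5 ≤ Module.finrank (ZMod 2) W := by
      by_contra hlt
      have : 2 ^ Module.finrank (ZMod 2) W ≤ 2 ^ 5 :=
        Nat.pow_le_pow_right (by norm_num) (by omega)
      omega
    exact pow_dvd_pow 2 h5
  omega

end

end Sextic

theorem stmt12 (V : Submodule (ZMod 2) (Fin 66 → ZMod 2))
    (hwt : ∀ v ∈ V, v ≠ 0 → wt v = 24 ∨ wt v = 32 ∨ wt v = 40 ∨ wt v = 56) :
    Module.finrank (ZMod 2) V ≤ 12 := by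
  by_contra h
  exact Sextic.final hwt (by omega)
end
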